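/- Let Ω_t = Σ_{i=1}^d v^i cos(2π(ω_i t + φ_i)) be a d-dimensional probing signal with V = [v^1 | ⋯ | v^d] invertible and frequencies ω_1,…,ω_d > 0 linearly independent over the rationals. Let X ∈ ℝ^d be a random vector with independent entries X_i = cos(2πU_i), where U_1,…,U_d are i.i.d. uniform on [0,1] (so each X_i has the arcsine law on [−1,1]). Then for any Borel measurable h: ℝ^d → ℝ with E[|h(VX)|] < ∞, for almost every choice of the phases (φ_1,…,φ_d): lim_{T→∞} (1/T)∫_0^T h(Ω_t) dt = lim_{T→∞} (1/T)∫_0^T h(Ω_{−t}) dt = E[h(VX)]. If in addition h is continuous, these limits hold for every choice of phases, and the convergence is uniform in the initial phases. -/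

import Mathlib

open Filter MeasureTheory Topology Real

noncomputable section

/-- The sinusoidal probing signal `Ω_t = Σ_i v^i cos(2π(ω_i t + φ_i)) ∈ ℝ^d`. -/
def probe {d : ℕ} (v : Fin d → Fin d → ℝ) (ω φ : Fin d → ℝ) (t : ℝ) : Fin d → ℝ :=
  fun j => ∑ i, v i j * Real.cos (2 * π * (ω i * t + φ i))

/-- `V X` where `X_i = cos (2π U_i)` and `U ∈ [0,1]^d`. -/
def Vcos {d : ℕ} (v : Fin d → Fin d → ℝ) (u : Fin d → ℝ) : Fin d → ℝ :=
  fun j => ∑ i, v i j * Real.cos (2 * π * u i)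

/-- `E[h(VX)]`, where the `X_i = cos(2π U_i)` are i.i.d. with the arcsine law:
`∫_{[0,1]^d} h(V·(cos 2πu_1, …, cos 2πu_d)) du`. -/
def arcsineMean {d : ℕ} (v : Fin d → Fin d → ℝ) (h : (Fin d → ℝ) → ℝ) : ℝ :=
  ∫ u in Set.univ.pi (fun _ : Fin d => Set.Icc (0:ℝ) 1), h (Vcos v u)


/-- The running maximum `max (0, S₁, …, S_N)` of the Birkhoff sums of `f` along `T`. -/
def birkhoffMax {X : Type*} (T : X → X) (f : X → ℝ) : ℕ → X → ℝ
  | 0 => fun _ => 0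
  | N + 1 => fun x => max 0 (f x + birkhoffMax T f N (T x))

lemma birkhoffMax_nonneg {X : Type*} (T : X → X) (f : X → ℝ) (N : ℕ) (x : X) :
    0 ≤ birkhoffMax T f N x := by
  cases N with
  | zero => exact le_rfl
  | succ N => exact le_max_left _ _

lemma birkhoffMax_le_succ {X : Type*} (T : X → X) (f : X → ℝ) (N : ℕ) (x : X) :
    birkhoffMax T f N x ≤ birkhoffMax T f (N + 1) x := by
  induction N generalizing x with
  | zero => exact birkhoffMax_nonneg _ _ _ _
  | succ N ih => exact max_le_max le_rfl (by linarith [ih (T x)])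

lemma birkhoffSum_le_birkhoffMax {X : Type*} (T : X → X) (f : X → ℝ) (N : ℕ) (x : X) :
    birkhoffSum T f N x ≤ birkhoffMax T f N x := by
  induction N generalizing x with
  | zero => simp [birkhoffMax]
  | succ N ih =>
    rw [birkhoffSum_succ']
    exact le_trans (by linarith [ih (T x)]) (le_max_right _ _)

section Maximal

variable {X : Type*} [MeasurableSpace X] {μ : Measure X}

lemma integrable_birkhoffMax {T : X → X} (hT : MeasurePreserving T μ μ) {f : X → ℝ}
    (hf : Integrable f μ) (N : ℕ) : Integrable (birkhoffMax T f N) μ := by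
  induction N with
  | zero => exact integrable_zero _ _ _
  | succ N ih =>
    exact (integrable_zero X ℝ μ).sup (hf.add (hT.integrable_comp_of_integrable ih))

lemma measurable_birkhoffMax {T : X → X} (hT : Measurable T) {f : X → ℝ}
    (hf : Measurable f) (N : ℕ) : Measurable (birkhoffMax T f N) := by
  induction N with
  | zero => exact measurable_const
  | succ N ih => exact measurable_const.max (hf.add (ih.comp hT))

/-- Hopf's maximal ergodic theorem (Garsia's proof). -/
lemma setIntegral_birkhoffMax_pos_nonneg {T : X → X} (hT : MeasurePreserving T μ μ) {f : X → ℝ}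
    (hf : Integrable f μ) (hfm : Measurable f) (N : ℕ) :
    0 ≤ ∫ x in {x | 0 < birkhoffMax T f N x}, f x ∂μ := by
  have hM := integrable_birkhoffMax hT hf N
  have hMT : Integrable (fun x => birkhoffMax T f N (T x)) μ := hT.integrable_comp_of_integrable hM
  have hmeas : MeasurableSet {x | 0 < birkhoffMax T f N x} :=
    measurableSet_lt measurable_const (measurable_birkhoffMax hT.measurable hfm N)
  have hmap : ∫ x, birkhoffMax T f N (T x) ∂μ = ∫ x, birkhoffMax T f N x ∂μ := by
    rw [← integral_map hT.measurable.aemeasurable (by rw [hT.map_eq]; exact hM.1), hT.map_eq]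
  rw [← integral_indicator hmeas]
  have : 0 = ∫ x, (birkhoffMax T f N x - birkhoffMax T f N (T x)) ∂μ := by
    rw [integral_sub hM hMT, hmap, sub_self]
  refine this.trans_le ?_
  refine integral_mono (hM.sub hMT) (hf.indicator hmeas) fun x => ?_
  by_cases hx : 0 < birkhoffMax T f N x
  · rw [Set.indicator_of_mem (by exact hx)]
    cases N with
    | zero => exact absurd hx (lt_irrefl _)
    | succ N =>
      have h1 := birkhoffMax_le_succ T f N (T x)
      have h2 : birkhoffMax T f (N + 1) x = f x + birkhoffMax T f N (T x) := by
        rcases max_choice 0 (f x + birkhoffMax T f N (T x)) with h | h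
        · exact absurd (h ▸ hx : (0:ℝ) < 0) (lt_irrefl _)
        · exact h
      dsimp only
      linarith
  · rw [Set.indicator_of_notMem (by exact hx)]
    have := birkhoffMax_nonneg T f N (T x)
    dsimp only
    linarith

/-- The weak-type maximal inequality for Birkhoff sums of a nonnegative function. -/
lemma measure_birkhoffSum_gt_le [IsProbabilityMeasure μ] {T : X → X}
    (hT : MeasurePreserving T μ μ) {F : X → ℝ}
    (hF : Integrable F μ) (hFm : Measurable F) (hF0 : ∀ x, 0 ≤ F x) {c : ℝ} (hc : 0 < c) :
    μ {x | ∃ n : ℕ, n * c < birkhoffSum T F n x} ≤ ENNReal.ofReal ((∫ x, F x ∂μ) / c) := by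
  set f : X → ℝ := fun x => F x - c with hf_def
  have hf : Integrable f μ := hF.sub (integrable_const c)
  have hfm : Measurable f := hFm.sub_const c
  have hsub : {x | ∃ n : ℕ, n * c < birkhoffSum T F n x} ⊆
      ⋃ n : ℕ, {x | 0 < birkhoffMax T f n x} := by
    rintro x ⟨n, hn⟩
    refine Set.mem_iUnion.2 ⟨n, lt_of_lt_of_le ?_ (birkhoffSum_le_birkhoffMax T f n x)⟩
    have : birkhoffSum T f n x = birkhoffSum T F n x - n * c := by
      simp [birkhoffSum, hf_def, Finset.sum_sub_distrib]
    linarith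
  refine (measure_mono hsub).trans ?_
  have hmono : Monotone fun n : ℕ => {x | 0 < birkhoffMax T f n x} :=
    monotone_nat_of_le_succ fun n x hx => lt_of_lt_of_le hx (birkhoffMax_le_succ T f n x)
  rw [hmono.measure_iUnion]
  refine iSup_le fun n => ?_
  have hmeas : MeasurableSet {x | 0 < birkhoffMax T f n x} :=
    measurableSet_lt measurable_const (measurable_birkhoffMax hT.measurable hfm n)
  have h1 := setIntegral_birkhoffMax_pos_nonneg hT hf hfm n
  rw [hf_def, integral_sub hF.integrableOn (integrable_const c).integrableOn,
    setIntegral_const, smul_eq_mul] at h1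
  have h2 : ∫ x in {x | 0 < birkhoffMax T f n x}, F x ∂μ ≤ ∫ x, F x ∂μ :=
    setIntegral_le_integral hF (Eventually.of_forall hF0)
  rw [← ENNReal.ofReal_toReal (measure_ne_top μ {x | 0 < birkhoffMax T f n x})]
  refine ENNReal.ofReal_le_ofReal ?_
  rw [le_div_iff₀ hc]
  exact le_trans (by simpa [Measure.real] using sub_nonneg.1 h1) h2

end Maximal

/-- A jointly measurable measure-preserving flow. -/
structure MeasurePreservingFlow {X : Type*} [MeasurableSpace X] (μ : Measure X)
    (θ : ℝ → X → X) : Prop where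
  measurable_uncurry : Measurable fun p : X × ℝ => θ p.2 p.1
  zero_apply : ∀ x, θ 0 x = x
  add_apply : ∀ s t x, θ (s + t) x = θ s (θ t x)
  measurePreserving : ∀ t, MeasurePreserving (θ t) μ μ

namespace MeasurePreservingFlow

variable {X : Type*} [MeasurableSpace X] {μ : Measure X} {θ : ℝ → X → X} {f : X → ℝ}

lemma integrable_prod [IsProbabilityMeasure μ] (hθ : MeasurePreservingFlow μ θ)
    (hf : Integrable f μ) (hfm : Measurable f) (T : ℝ) :
    Integrable (fun p : X × ℝ => f (θ p.2 p.1)) (μ.prod (volume.restrict (Set.Ioc 0 T))) := by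
  have hmeas : Measurable fun p : X × ℝ => f (θ p.2 p.1) := hfm.comp hθ.measurable_uncurry
  rw [integrable_prod_iff' hmeas.aestronglyMeasurable]
  refine ⟨Eventually.of_forall fun t => (hθ.measurePreserving t).integrable_comp_of_integrable hf,
    ?_⟩
  have : ∀ t, ∫ x, ‖f (θ t x)‖ ∂μ = ∫ x, ‖f x‖ ∂μ := fun t => by
    rw [← integral_map (f := fun x => ‖f x‖) (hθ.measurePreserving t).measurable.aemeasurable
      hfm.norm.aestronglyMeasurable, (hθ.measurePreserving t).map_eq]
  simp only [this]
  exact integrable_const _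

lemma ae_intervalIntegrable [IsProbabilityMeasure μ]
    (hθ : MeasurePreservingFlow μ θ) (hf : Integrable f μ)
    (hfm : Measurable f) :
    ∀ᵐ x ∂μ, ∀ T : ℝ, 0 ≤ T → IntervalIntegrable (fun t => f (θ t x)) volume 0 T := by
  have h : ∀ᵐ x ∂μ, ∀ n : ℕ, IntervalIntegrable (fun t => f (θ t x)) volume 0 n := by
    refine ae_all_iff.2 fun n => ?_
    filter_upwards [(hθ.integrable_prod hf hfm n).prod_right_ae] with x hx
    exact (intervalIntegrable_iff_integrableOn_Ioc_of_le n.cast_nonneg).2 hx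
  filter_upwards [h] with x hx T hT
  obtain ⟨n, hn⟩ := exists_nat_ge T
  refine (hx n).mono_set ?_
  rw [Set.uIcc_of_le hT, Set.uIcc_of_le n.cast_nonneg]
  exact Set.Icc_subset_Icc_right hn

lemma iterate_one_eq (hθ : MeasurePreservingFlow μ θ) (n : ℕ) (x : X) :
    (θ 1)^[n] x = θ n x := by
  induction n with
  | zero => simp [hθ.zero_apply]
  | succ n ih =>
    rw [Function.iterate_succ_apply', ih, ← hθ.add_apply]
    congr 1
    push_cast
    ring

lemma birkhoffSum_integral_eq (hθ : MeasurePreservingFlow μ θ) {x : X}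
    (hx : ∀ T : ℝ, 0 ≤ T → IntervalIntegrable (fun t => |f (θ t x)|) volume 0 T) (n : ℕ) :
    birkhoffSum (θ 1) (fun y => ∫ t in (0:ℝ)..1, |f (θ t y)|) n x
      = ∫ t in (0:ℝ)..n, |f (θ t x)| := by
  induction n with
  | zero => simp
  | succ n ih =>
    have h0 := hx n n.cast_nonneg
    have h1 := hx (n + 1 : ℝ) (by positivity)
    rw [birkhoffSum_succ, ih, hθ.iterate_one_eq]
    simp only [← hθ.add_apply]
    rw [intervalIntegral.integral_comp_add_right (fun t => |f (θ t x)|) (n : ℝ)]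
    push_cast
    rw [zero_add, add_comm (1:ℝ), intervalIntegral.integral_add_adjacent_intervals h0
      (h0.symm.trans h1)]

/-- The weak-type maximal inequality for the ergodic averages of a flow over times `T ≥ 1`. -/
lemma measure_average_gt_le [IsProbabilityMeasure μ]
    (hθ : MeasurePreservingFlow μ θ) (hf : Integrable f μ)
    (hfm : Measurable f) {c : ℝ} (hc : 0 < c) :
    μ {x | ∃ T : ℝ, 1 ≤ T ∧ c < T⁻¹ * ∫ t in (0:ℝ)..T, |f (θ t x)|}
      ≤ ENNReal.ofReal ((∫ x, |f x| ∂μ) / (c / 2)) := by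
  set F : X → ℝ := fun y => ∫ t in (0:ℝ)..1, |f (θ t y)| with hF_def
  have hF_eq : F = fun y => ∫ t in Set.Ioc (0:ℝ) 1, |f (θ t y)| := by
    ext y
    exact intervalIntegral.integral_of_le zero_le_one
  have hprod := hθ.integrable_prod hf.abs hfm.abs 1
  have hFint : Integrable F μ := hF_eq ▸ hprod.integral_prod_left
  have hFm : Measurable F := by
    rw [hF_eq]
    exact (StronglyMeasurable.integral_prod_right
      (f := fun y t => |f (θ t y)|)
      (hfm.abs.comp hθ.measurable_uncurry).stronglyMeasurable).measurable
  have hF0 : ∀ x, 0 ≤ F x := fun x =>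
    intervalIntegral.integral_nonneg zero_le_one fun t _ => abs_nonneg _
  have hFI : ∫ x, F x ∂μ = ∫ x, |f x| ∂μ := by
    rw [hF_eq, integral_integral_swap hprod]
    have : ∀ t, ∫ x, |f (θ t x)| ∂μ = ∫ x, |f x| ∂μ := fun t => by
      rw [← integral_map (f := fun x => |f x|) (hθ.measurePreserving t).measurable.aemeasurable
        hfm.abs.aestronglyMeasurable, (hθ.measurePreserving t).map_eq]
    simp [this]
  have key := measure_birkhoffSum_gt_le (hθ.measurePreserving 1) hFint hFm hF0 (half_pos hc)
  rw [hFI] at key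
  refine le_trans (measure_mono_ae ?_) key
  filter_upwards [hθ.ae_intervalIntegrable hf.abs hfm.abs] with x hx
  rintro ⟨T, hT, hcT⟩
  have hT0 : 0 < T := by linarith
  refine ⟨⌈T⌉₊, ?_⟩
  rw [hθ.birkhoffSum_integral_eq hx]
  have hn : (⌈T⌉₊ : ℝ) < T + 1 := Nat.ceil_lt_add_one hT0.le
  have hle : ∫ t in (0:ℝ)..T, |f (θ t x)| ≤ ∫ t in (0:ℝ)..(⌈T⌉₊ : ℝ), |f (θ t x)| :=
    intervalIntegral.integral_mono_interval le_rfl hT0.le (Nat.le_ceil T)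
      (Eventually.of_forall fun t => abs_nonneg _) (hx _ (Nat.cast_nonneg _))
  have h1 : T * c < ∫ t in (0:ℝ)..T, |f (θ t x)| := by
    rwa [inv_mul_eq_div, lt_div_iff₀ hT0, mul_comm] at hcT
  nlinarith

/-- Banach's principle: if `f` is an `L¹`-limit of functions whose ergodic averages converge
everywhere to their mean, then the ergodic averages of `f` converge almost everywhere. -/
lemma ae_tendsto_average [IsProbabilityMeasure μ]
    (hθ : MeasurePreservingFlow μ θ) (hf : Integrable f μ)
    (hfm : Measurable f)
    (hdense : ∀ ε : ℝ, 0 < ε → ∃ g : X → ℝ, Measurable g ∧ Integrable g μ ∧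
      ∫ x, |f x - g x| ∂μ ≤ ε ∧
      ∀ x, Tendsto (fun T : ℝ => T⁻¹ * ∫ t in (0:ℝ)..T, g (θ t x)) atTop (𝓝 (∫ x, g x ∂μ))) :
    ∀ᵐ x ∂μ, Tendsto (fun T : ℝ => T⁻¹ * ∫ t in (0:ℝ)..T, f (θ t x)) atTop (𝓝 (∫ x, f x ∂μ)) := by
  have main : ∀ η : ℝ, 0 < η → ∀ᵐ x ∂μ, ∀ᶠ T : ℝ in atTop,
      |T⁻¹ * (∫ t in (0:ℝ)..T, f (θ t x)) - ∫ x, f x ∂μ| < 3 * η := by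
    intro η hη
    have hbound : ∀ ε : ℝ, 0 < ε → ε < η → μ {x | ¬ ∀ᶠ T : ℝ in atTop,
        |T⁻¹ * (∫ t in (0:ℝ)..T, f (θ t x)) - ∫ x, f x ∂μ| < 3 * η}
        ≤ ENNReal.ofReal (ε / (η / 2)) := by
      intro ε hε hεη
      obtain ⟨g, hgm, hg, hfg, hconv⟩ := hdense ε hε
      have hmax := hθ.measure_average_gt_le (hf.sub hg) (hfm.sub hgm) hη
      refine le_trans (measure_mono_ae ?_) (hmax.trans (ENNReal.ofReal_le_ofReal
        (div_le_div_of_nonneg_right hfg (half_pos hη).le)))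
      filter_upwards [hθ.ae_intervalIntegrable hf hfm, hθ.ae_intervalIntegrable hg hgm]
        with x hfx hgx hx
      by_contra hnot
      refine hx ?_
      filter_upwards [eventually_ge_atTop (1:ℝ), Metric.tendsto_nhds.1 (hconv x) η hη]
        with T hT hgT
      have hT0 : 0 < T := by linarith
      have hA : T⁻¹ * ∫ t in (0:ℝ)..T, |f (θ t x) - g (θ t x)| ≤ η := by
        by_contra hlt
        exact hnot ⟨T, hT, not_le.1 hlt⟩
      have hB : |T⁻¹ * (∫ t in (0:ℝ)..T, f (θ t x)) - T⁻¹ * ∫ t in (0:ℝ)..T, g (θ t x)|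
          ≤ T⁻¹ * ∫ t in (0:ℝ)..T, |f (θ t x) - g (θ t x)| := by
        rw [← mul_sub, ← intervalIntegral.integral_sub (hfx T hT0.le) (hgx T hT0.le), abs_mul,
          abs_of_pos (inv_pos.2 hT0)]
        exact mul_le_mul_of_nonneg_left
          (intervalIntegral.abs_integral_le_integral_abs hT0.le) (inv_pos.2 hT0).le
      have hC : |∫ x, f x ∂μ - ∫ x, g x ∂μ| ≤ ε := by
        rw [← integral_sub hf hg]
        exact (abs_integral_le_integral_abs).trans hfg
      rw [Real.dist_eq] at hgT
      rw [abs_lt] at hgT ⊢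
      rw [abs_le] at hB hC
      constructor <;> linarith [hgT.1, hgT.2, hB.1, hB.2, hC.1, hC.2]
    have hlim : Tendsto (fun ε : ℝ => ENNReal.ofReal (ε / (η / 2))) (𝓝[>] 0) (𝓝 0) := by
      have : Tendsto (fun ε : ℝ => ENNReal.ofReal (ε / (η / 2))) (𝓝 0)
          (𝓝 (ENNReal.ofReal (0 / (η / 2)))) :=
        (ENNReal.continuous_ofReal.comp (continuous_id.div_const _)).tendsto 0
      rw [zero_div, ENNReal.ofReal_zero] at this
      exact this.mono_left nhdsWithin_le_nhds
    refine nonpos_iff_eq_zero.1 (ge_of_tendsto hlim ?_)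
    filter_upwards [Ioo_mem_nhdsGT hη] with ε hε using hbound ε hε.1 hε.2
  have hall : ∀ᵐ x ∂μ, ∀ n : ℕ, ∀ᶠ T : ℝ in atTop,
      |T⁻¹ * (∫ t in (0:ℝ)..T, f (θ t x)) - ∫ x, f x ∂μ| < 3 * (1 / ((n : ℝ) + 1)) :=
    ae_all_iff.2 fun n => main _ (by positivity)
  filter_upwards [hall] with x hx
  refine Metric.tendsto_nhds.2 fun ε hε => ?_
  obtain ⟨n, hn⟩ := exists_nat_one_div_lt (show 0 < ε / 3 by linarith)
  filter_upwards [hx n] with T hT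
  rw [Real.dist_eq]
  linarith

end MeasurePreservingFlow

instance isProbabilityMeasure_volume_unitAddCircle :
    IsProbabilityMeasure (volume : Measure UnitAddCircle) :=
  ⟨UnitAddCircle.measure_univ⟩

instance isProbabilityMeasure_volume_unitAddTorus {d : ℕ} :
    IsProbabilityMeasure (volume : Measure (UnitAddTorus (Fin d))) :=
  inferInstanceAs (IsProbabilityMeasure
    (Measure.pi fun _ : Fin d => (volume : Measure UnitAddCircle)))

/-- The linear flow with velocity `w` on the torus. -/
def torusFlow {d : ℕ} (w : Fin d → ℝ) (t : ℝ) (x : UnitAddTorus (Fin d)) : UnitAddTorus (Fin d) :=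
  fun i => x i + ((w i * t : ℝ) : UnitAddCircle)

section TorusFlow

variable {d : ℕ} {w : Fin d → ℝ}

lemma continuous_torusFlow_uncurry (w : Fin d → ℝ) :
    Continuous fun p : UnitAddTorus (Fin d) × ℝ => torusFlow w p.2 p.1 := by
  refine continuous_pi fun i => ?_
  exact ((continuous_apply i).comp continuous_fst).add
    ((AddCircle.continuous_mk' 1).comp (continuous_const.mul continuous_snd))

lemma measurePreservingFlow_torusFlow (w : Fin d → ℝ) :
    MeasurePreservingFlow (volume : Measure (UnitAddTorus (Fin d))) (torusFlow w) where
  measurable_uncurry := by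
    have h := continuous_torusFlow_uncurry w
    exact h.measurable
  zero_apply x := by
    ext i
    simp [torusFlow]
  add_apply s t x := by
    ext i
    simp only [torusFlow, mul_add, AddCircle.coe_add]
    abel
  measurePreserving t :=
    measurePreserving_add_right (volume : Measure (UnitAddTorus (Fin d)))
      (fun i => ((w i * t : ℝ) : UnitAddCircle))

lemma mFourier_torusFlow (w : Fin d → ℝ) (n : Fin d → ℤ) (t : ℝ) (x : UnitAddTorus (Fin d)) :
    UnitAddTorus.mFourier n (torusFlow w t x) =
      UnitAddTorus.mFourier n x *
        Complex.exp (((2 * π * ∑ i, n i * w i : ℝ) : ℂ) * Complex.I * t) := by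
  simp only [UnitAddTorus.mFourier, ContinuousMap.coe_mk, torusFlow]
  have h : ∀ i, (fourier (n i) (x i + ((w i * t : ℝ) : UnitAddCircle)) : ℂ) =
      fourier (n i) (x i) * Complex.exp (2 * π * Complex.I * n i * (w i * t)) := fun i => by
    rw [fourier_apply, smul_add, AddCircle.toCircle_add, Circle.coe_mul, ← fourier_apply,
      ← fourier_apply, fourier_coe_apply]
    push_cast
    rw [div_one]
  simp only [h]
  rw [Finset.prod_mul_distrib, ← Complex.exp_sum]
  congr 2
  push_cast
  simp only [Finset.mul_sum, Finset.sum_mul]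
  refine Finset.sum_congr rfl fun i _ => ?_
  ring

lemma integral_mFourier_eq_zero (hw : LinearIndependent ℚ w) {n : Fin d → ℤ} (hn : n ≠ 0) :
    2 * π * ∑ i, (n i : ℝ) * w i ≠ 0 ∧ ∫ x, UnitAddTorus.mFourier n x = 0 := by
  have hc : 2 * π * ∑ i, (n i : ℝ) * w i ≠ 0 := by
    refine mul_ne_zero (by positivity) fun h0 => hn ?_
    ext i
    have := Fintype.linearIndependent_iff.1 hw (fun i => (n i : ℚ))
      (by simpa [Rat.smul_def] using h0) i
    exact_mod_cast this
  refine ⟨hc, ?_⟩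
  set c := 2 * π * ∑ i, (n i : ℝ) * w i
  have hθ := (measurePreservingFlow_torusFlow w).measurePreserving (π / c)
  have h1 : ∫ x, UnitAddTorus.mFourier n (torusFlow w (π / c) x) =
      ∫ x, UnitAddTorus.mFourier n x := by
    rw [← integral_map (f := fun x => UnitAddTorus.mFourier n x) hθ.measurable.aemeasurable
      (UnitAddTorus.mFourier n).continuous.aestronglyMeasurable, hθ.map_eq]
  have hexp : Complex.exp ((c : ℂ) * Complex.I * ((π / c : ℝ) : ℂ)) = -1 := by
    rw [← Complex.exp_pi_mul_I]
    congr 1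
    have : (c : ℂ) ≠ 0 := by exact_mod_cast hc
    push_cast
    field_simp
  simp only [mFourier_torusFlow] at h1
  rw [integral_mul_const, hexp] at h1
  linear_combination (-1 / 2 : ℂ) * h1

/-- Weyl equidistribution for trigonometric monomials, uniformly in the initial point. -/
lemma tendstoUniformly_average_mFourier (hw : LinearIndependent ℚ w) (n : Fin d → ℤ) :
    TendstoUniformly
      (fun (T : ℝ) x => (T : ℂ)⁻¹ * ∫ t in (0:ℝ)..T, UnitAddTorus.mFourier n (torusFlow w t x))
      (fun _ => ∫ x, UnitAddTorus.mFourier n x) atTop := by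
  rw [Metric.tendstoUniformly_iff]
  intro ε hε
  rcases eq_or_ne n 0 with rfl | hn
  · filter_upwards [eventually_gt_atTop 0] with T hT x
    have : (T : ℂ) ≠ 0 := by exact_mod_cast hT.ne'
    simp [UnitAddTorus.mFourier_zero, this, hε]
  · obtain ⟨hc, h0⟩ := integral_mFourier_eq_zero hw hn
    rw [h0]
    simp only [mFourier_torusFlow]
    set c := 2 * π * ∑ i, (n i : ℝ) * w i
    have hcI : (c : ℂ) * Complex.I ≠ 0 := mul_ne_zero (by exact_mod_cast hc) Complex.I_ne_zero
    have hlim : Tendsto (fun T : ℝ => T⁻¹ * (2 / |c|)) atTop (𝓝 0) := by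
      simpa using tendsto_inv_atTop_zero.mul_const (2 / |c|)
    filter_upwards [eventually_gt_atTop 0, hlim.eventually_lt_const hε] with T hT hTε x
    rw [dist_zero_left, intervalIntegral.integral_const_mul, integral_exp_mul_complex hcI]
    refine lt_of_le_of_lt ?_ hTε
    have hx : ‖UnitAddTorus.mFourier n x‖ ≤ 1 :=
      ((UnitAddTorus.mFourier n).norm_coe_le_norm x).trans UnitAddTorus.mFourier_norm.le
    have he : ∀ s : ℝ, ‖Complex.exp ((c : ℂ) * Complex.I * s)‖ = 1 := fun s => by
      rw [show (c : ℂ) * Complex.I * s = ((c * s : ℝ) : ℂ) * Complex.I by push_cast; ring,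
        Complex.norm_exp_ofReal_mul_I]
    have h2 : ‖Complex.exp ((c : ℂ) * Complex.I * T) -
        Complex.exp ((c : ℂ) * Complex.I * (0 : ℝ))‖ ≤ 2 := by
      refine (norm_sub_le _ _).trans ?_
      rw [he, he]
      norm_num
    rw [norm_mul, norm_mul, norm_div, norm_inv, Complex.norm_real, Real.norm_of_nonneg hT.le,
      norm_mul, Complex.norm_I, mul_one, Complex.norm_real, Real.norm_eq_abs]
    refine mul_le_mul_of_nonneg_left ?_ (inv_pos.2 hT).le
    calc _ ≤ 1 * (2 / |c|) := by gcongr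
      _ = _ := one_mul _

lemma intervalIntegrable_torusFlow {E : Type*} [NormedAddCommGroup E] (w : Fin d → ℝ)
    {g : UnitAddTorus (Fin d) → E} (hg : Continuous g) (x : UnitAddTorus (Fin d)) (a b : ℝ) :
    IntervalIntegrable (fun t => g (torusFlow w t x)) volume a b :=
  (hg.comp ((continuous_torusFlow_uncurry w).comp
    (continuous_const.prodMk continuous_id))).intervalIntegrable a b

lemma integrable_of_continuous_torus {E : Type*} [NormedAddCommGroup E]
    {g : UnitAddTorus (Fin d) → E} (hg : Continuous g) : Integrable g :=
  hg.integrable_of_hasCompactSupport (HasCompactSupport.of_compactSpace g)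

/-- Weyl equidistribution for continuous complex functions, uniformly in the initial point. -/
lemma tendstoUniformly_average_continuousMap (hw : LinearIndependent ℚ w)
    (g : C(UnitAddTorus (Fin d), ℂ)) :
    TendstoUniformly (fun (T : ℝ) x => (T : ℂ)⁻¹ * ∫ t in (0:ℝ)..T, g (torusFlow w t x))
      (fun _ => ∫ x, g x) atTop := by
  have hspan : ∀ p ∈ Submodule.span ℂ (Set.range (UnitAddTorus.mFourier (d := Fin d))),
      TendstoUniformly (fun (T : ℝ) x => (T : ℂ)⁻¹ * ∫ t in (0:ℝ)..T, p (torusFlow w t x))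
      (fun _ => ∫ x, p x) atTop := by
    intro p hp
    induction hp using Submodule.span_induction with
    | mem p hp =>
      obtain ⟨n, rfl⟩ := hp
      exact tendstoUniformly_average_mFourier hw n
    | zero =>
      simp only [ContinuousMap.zero_apply, intervalIntegral.integral_zero, mul_zero,
        integral_zero]
      exact Metric.tendstoUniformly_iff.2 fun ε hε => Eventually.of_forall fun T x => by simpa
    | add p q _ _ hp hq =>
      convert! hp.add hq using 1
      · ext T x
        simp only [ContinuousMap.add_apply, Pi.add_apply]
        rw [intervalIntegral.integral_add (intervalIntegrable_torusFlow w p.continuous x 0 T)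
          (intervalIntegrable_torusFlow w q.continuous x 0 T), mul_add]
      · ext x
        exact integral_add (integrable_of_continuous_torus p.continuous)
          (integrable_of_continuous_torus q.continuous)
    | smul a p _ hp =>
      convert! (uniformContinuous_const_smul a).comp_tendstoUniformly hp using 1
      · ext T x
        simp only [ContinuousMap.smul_apply, Function.comp, smul_eq_mul,
          intervalIntegral.integral_const_mul]
        ring
      · ext x
        simp only [ContinuousMap.smul_apply, Function.comp, smul_eq_mul, integral_const_mul]
  rw [Metric.tendstoUniformly_iff]
  intro ε hε
  have hg : g ∈ closure (Submodule.span ℂ (Set.range (UnitAddTorus.mFourier (d := Fin d))) :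
      Set C(UnitAddTorus (Fin d), ℂ)) := by
    rw [← Submodule.topologicalClosure_coe, UnitAddTorus.span_mFourier_closure_eq_top]
    trivial
  obtain ⟨p, hp, hgp⟩ := Metric.mem_closure_iff.1 hg (ε / 3) (by positivity)
  have hgp' : ∀ x, ‖g x - p x‖ ≤ ε / 3 := fun x => by
    rw [← dist_eq_norm]
    exact (ContinuousMap.dist_apply_le_dist x).trans hgp.le
  filter_upwards [Metric.tendstoUniformly_iff.1 (hspan p hp) (ε / 3) (by positivity),
    eventually_gt_atTop 0] with T hT hT0 x
  have h1 : dist (∫ x, g x) (∫ x, p x) ≤ ε / 3 := by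
    rw [dist_eq_norm, ← integral_sub (integrable_of_continuous_torus g.continuous)
      (integrable_of_continuous_torus p.continuous)]
    simpa using norm_integral_le_of_norm_le_const
      (μ := (volume : Measure (UnitAddTorus (Fin d)))) (Eventually.of_forall hgp')
  have h2 : dist ((T : ℂ)⁻¹ * ∫ t in (0:ℝ)..T, p (torusFlow w t x))
      ((T : ℂ)⁻¹ * ∫ t in (0:ℝ)..T, g (torusFlow w t x)) ≤ ε / 3 := by
    rw [dist_comm, dist_eq_norm, ← mul_sub,
      ← intervalIntegral.integral_sub (intervalIntegrable_torusFlow w g.continuous x 0 T)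
        (intervalIntegrable_torusFlow w p.continuous x 0 T), norm_mul, norm_inv,
      Complex.norm_real, Real.norm_of_nonneg hT0.le, inv_mul_le_iff₀ hT0, mul_comm]
    have := intervalIntegral.norm_integral_le_of_norm_le_const (a := 0) (b := T)
      (f := fun t => g (torusFlow w t x) - p (torusFlow w t x)) fun t _ => hgp' _
    rwa [sub_zero, abs_of_pos hT0] at this
  have h3 := hT x
  have h4 := dist_triangle4 (∫ x, g x) (∫ x, p x)
    ((T : ℂ)⁻¹ * ∫ t in (0:ℝ)..T, p (torusFlow w t x))
    ((T : ℂ)⁻¹ * ∫ t in (0:ℝ)..T, g (torusFlow w t x))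
  linarith

/-- Weyl equidistribution for continuous real functions, uniformly in the initial point. -/
lemma tendstoUniformly_average_of_continuous (hw : LinearIndependent ℚ w)
    {g : UnitAddTorus (Fin d) → ℝ} (hg : Continuous g) :
    TendstoUniformly (fun (T : ℝ) x => T⁻¹ * ∫ t in (0:ℝ)..T, g (torusFlow w t x))
      (fun _ => ∫ x, g x) atTop := by
  have h := tendstoUniformly_average_continuousMap hw
    ⟨fun x => (g x : ℂ), Complex.continuous_ofReal.comp hg⟩
  rw [Metric.tendstoUniformly_iff] at h ⊢
  intro ε hε
  filter_upwards [h ε hε] with T hT x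
  have := hT x
  simp only [ContinuousMap.coe_mk, intervalIntegral.integral_ofReal, integral_complex_ofReal]
    at this
  rw [← Complex.ofReal_inv, ← Complex.ofReal_mul] at this
  rwa [Complex.dist_eq, ← Complex.ofReal_sub, Complex.norm_real, ← dist_eq_norm] at this

/-- The pointwise ergodic theorem for a rationally independent linear flow on the torus. -/
lemma ae_tendsto_average_torusFlow (hw : LinearIndependent ℚ w)
    {f : UnitAddTorus (Fin d) → ℝ} (hf : Integrable f) (hfm : Measurable f) :
    ∀ᵐ x, Tendsto (fun T : ℝ => T⁻¹ * ∫ t in (0:ℝ)..T, f (torusFlow w t x)) atTop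
      (𝓝 (∫ x, f x)) := by
  refine (measurePreservingFlow_torusFlow w).ae_tendsto_average hf hfm fun ε hε => ?_
  obtain ⟨g, hfg, hg⟩ := hf.exists_boundedContinuous_integral_sub_le hε
  exact ⟨g, g.continuous.measurable, hg, hfg,
    fun x => (tendstoUniformly_average_of_continuous hw g.continuous).tendsto_at x⟩

end TorusFlow

section Torus

variable {d : ℕ}

/-- The covering map from `ℝ^d` to the torus. -/
def torusMk (φ : Fin d → ℝ) : UnitAddTorus (Fin d) := fun i => (φ i : UnitAddCircle)

lemma measurePreserving_torusMk (a : Fin d → ℝ) :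
    MeasurePreserving (torusMk (d := d))
      (volume.restrict (Set.univ.pi fun i => Set.Ioc (a i) (a i + 1))) volume := by
  rw [volume_pi, Measure.restrict_pi_pi]
  exact measurePreserving_pi _ _ fun i => UnitAddCircle.measurePreserving_mk (a i)

lemma ae_torusMk {p : UnitAddTorus (Fin d) → Prop} (hp : ∀ᵐ x, p x) :
    ∀ᵐ φ : Fin d → ℝ, p (torusMk φ) := by
  have h : ∀ m : Fin d → ℤ, ∀ᵐ φ : Fin d → ℝ,
      φ ∈ (Set.univ.pi fun i => Set.Ioc (m i : ℝ) (m i + 1)) → p (torusMk φ) := fun m =>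
    (ae_restrict_iff' (MeasurableSet.univ_pi fun i => measurableSet_Ioc)).1
      ((measurePreserving_torusMk fun i => (m i : ℝ)).quasiMeasurePreserving.ae hp)
  filter_upwards [ae_all_iff.2 h] with φ hφ
  refine hφ (fun i => ⌈φ i⌉ - 1) fun i _ => ?_
  push_cast
  exact ⟨by linarith [Int.ceil_lt_add_one (φ i)], by linarith [Int.le_ceil (φ i)]⟩

lemma restrict_univ_pi_Icc :
    (volume : Measure (Fin d → ℝ)).restrict (Set.univ.pi fun _ => Set.Icc (0:ℝ) 1) =
      volume.restrict (Set.univ.pi fun i => Set.Ioc ((0 : Fin d → ℝ) i) ((0 : Fin d → ℝ) i + 1)) := by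
  simp only [Pi.zero_apply, zero_add]
  exact (Measure.restrict_congr_set Measure.pi_Ioc_ae_eq_pi_Icc).symm

/-- The function on the torus whose lift to `ℝ^d` is `Vcos v`. -/
def torusVcos (v : Fin d → Fin d → ℝ) (x : UnitAddTorus (Fin d)) : Fin d → ℝ :=
  fun j => ∑ i, v i j * (fourier 1 (x i) : ℂ).re

lemma continuous_torusVcos (v : Fin d → Fin d → ℝ) : Continuous (torusVcos v) :=
  continuous_pi fun _ => continuous_finsetSum _ fun i _ => continuous_const.mul
    (Complex.continuous_re.comp ((fourier 1).continuous.comp (continuous_apply i)))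

lemma torusVcos_torusMk (v : Fin d → Fin d → ℝ) (φ : Fin d → ℝ) :
    torusVcos v (torusMk φ) = Vcos v φ := by
  ext j
  refine Finset.sum_congr rfl fun i _ => ?_
  rw [torusMk, fourier_coe_apply,
    show (2 * π * Complex.I * (1 : ℤ) * φ i / (1 : ℝ) : ℂ) =
      ((2 * π * φ i : ℝ) : ℂ) * Complex.I by push_cast; ring, Complex.exp_ofReal_mul_I_re]

lemma torusVcos_torusFlow (v : Fin d → Fin d → ℝ) (w φ : Fin d → ℝ) (t : ℝ) :
    torusVcos v (torusFlow w t (torusMk φ)) = probe v w φ t := by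
  have : torusFlow w t (torusMk φ) = torusMk fun i => w i * t + φ i := by
    ext i
    simp only [torusFlow, torusMk, AddCircle.coe_add]
    exact add_comm _ _
  rw [this, torusVcos_torusMk]
  rfl

lemma probe_neg (v : Fin d → Fin d → ℝ) (ω φ : Fin d → ℝ) (t : ℝ) :
    probe v ω φ (-t) = probe v (-ω) φ t := by
  ext j
  simp only [probe, Pi.neg_apply, mul_neg, neg_mul]

lemma integrable_torusVcos {v : Fin d → Fin d → ℝ} {h : (Fin d → ℝ) → ℝ} (hmeas : Measurable h)
    (hint : IntegrableOn (fun u : Fin d → ℝ => h (Vcos v u))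
      (Set.univ.pi (fun _ : Fin d => Set.Icc (0:ℝ) 1))) :
    Integrable fun x => h (torusVcos v x) := by
  rw [IntegrableOn, restrict_univ_pi_Icc] at hint
  have hm : Measurable fun x => h (torusVcos v x) := hmeas.comp (continuous_torusVcos v).measurable
  refine ((measurePreserving_torusMk 0).integrable_comp hm.aestronglyMeasurable).1 ?_
  simpa only [Function.comp_def, torusVcos_torusMk] using hint

lemma integral_torusVcos (v : Fin d → Fin d → ℝ) {h : (Fin d → ℝ) → ℝ} (hmeas : Measurable h) :
    ∫ x, h (torusVcos v x) = arcsineMean v h := by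
  have hm : Measurable fun x => h (torusVcos v x) := hmeas.comp (continuous_torusVcos v).measurable
  have hmk := measurePreserving_torusMk (0 : Fin d → ℝ)
  have key := integral_map (μ := volume.restrict
      (Set.univ.pi fun i => Set.Ioc ((0 : Fin d → ℝ) i) ((0 : Fin d → ℝ) i + 1)))
    hmk.measurable.aemeasurable (f := fun x => h (torusVcos v x)) hm.aestronglyMeasurable
  rw [hmk.map_eq] at key
  rw [key, arcsineMean, restrict_univ_pi_Icc]
  simp only [torusVcos_torusMk]

lemma ae_tendsto_average_probe (v : Fin d → Fin d → ℝ) {w : Fin d → ℝ}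
    (hw : LinearIndependent ℚ w) {h : (Fin d → ℝ) → ℝ} (hmeas : Measurable h)
    (hint : IntegrableOn (fun u : Fin d → ℝ => h (Vcos v u))
      (Set.univ.pi (fun _ : Fin d => Set.Icc (0:ℝ) 1))) :
    ∀ᵐ φ : Fin d → ℝ, Tendsto (fun T : ℝ => T⁻¹ * ∫ t in (0:ℝ)..T, h (probe v w φ t))
      atTop (𝓝 (arcsineMean v h)) := by
  have key := ae_torusMk (ae_tendsto_average_torusFlow hw (integrable_torusVcos hmeas hint)
    (hmeas.comp (continuous_torusVcos v).measurable))
  simpa only [torusVcos_torusFlow, integral_torusVcos v hmeas] using key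

lemma tendstoUniformly_average_probe (v : Fin d → Fin d → ℝ) {w : Fin d → ℝ}
    (hw : LinearIndependent ℚ w) {h : (Fin d → ℝ) → ℝ} (hh : Continuous h) :
    TendstoUniformly
      (fun T : ℝ => fun φ : Fin d → ℝ => T⁻¹ * ∫ t in (0:ℝ)..T, h (probe v w φ t))
      (fun _ => arcsineMean v h) atTop := by
  have key := (tendstoUniformly_average_of_continuous hw
    (hh.comp (continuous_torusVcos v))).comp torusMk
  simpa only [Function.comp_def, torusVcos_torusFlow, integral_torusVcos v hh.measurable] using key

end Torus

/-- arcsine-law LLN for the probing signal, forwards and backwards in time,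
with uniform-in-phase convergence for continuous `h`. -/
theorem arcsine_law_LLN {d : ℕ} (v : Fin d → Fin d → ℝ)
    (hV : IsUnit (Matrix.of fun j i => v i j))
    (ω : Fin d → ℝ) (hpos : ∀ i, 0 < ω i) (hind : LinearIndependent ℚ ω)
    (h : (Fin d → ℝ) → ℝ) (hmeas : Measurable h)
    (hint : IntegrableOn (fun u : Fin d → ℝ => h (Vcos v u))
      (Set.univ.pi (fun _ : Fin d => Set.Icc (0:ℝ) 1))) :
    (∀ᵐ φ ∂(volume : Measure (Fin d → ℝ)),
      Tendsto (fun T : ℝ => T⁻¹ * ∫ t in (0:ℝ)..T, h (probe v ω φ t))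
        atTop (𝓝 (arcsineMean v h)) ∧
      Tendsto (fun T : ℝ => T⁻¹ * ∫ t in (0:ℝ)..T, h (probe v ω φ (-t)))
        atTop (𝓝 (arcsineMean v h))) ∧
    (Continuous h →
      (∀ φ : Fin d → ℝ,
        Tendsto (fun T : ℝ => T⁻¹ * ∫ t in (0:ℝ)..T, h (probe v ω φ t))
          atTop (𝓝 (arcsineMean v h)) ∧
        Tendsto (fun T : ℝ => T⁻¹ * ∫ t in (0:ℝ)..T, h (probe v ω φ (-t)))
          atTop (𝓝 (arcsineMean v h))) ∧
      TendstoUniformly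
        (fun T : ℝ => fun φ : Fin d → ℝ => T⁻¹ * ∫ t in (0:ℝ)..T, h (probe v ω φ t))
        (fun _ => arcsineMean v h) atTop ∧
      TendstoUniformly
        (fun T : ℝ => fun φ : Fin d → ℝ => T⁻¹ * ∫ t in (0:ℝ)..T, h (probe v ω φ (-t)))
        (fun _ => arcsineMean v h) atTop) := by
  have hneg : LinearIndependent ℚ (-ω) := hind.neg
  simp only [probe_neg]
  refine ⟨?_, fun hc => ?_⟩
  · filter_upwards [ae_tendsto_average_probe v hind hmeas hint,
      ae_tendsto_average_probe v hneg hmeas hint] with φ h1 h2 using ⟨h1, h2⟩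
  · have h1 := tendstoUniformly_average_probe v hind hc
    have h2 := tendstoUniformly_average_probe v hneg hc
    exact ⟨fun φ => ⟨h1.tendsto_at φ, h2.tendsto_at φ⟩, h1, h2⟩
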